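/- arXiv:1701.06307 — 2 statements merged into one kernel-verified Lean document; each statement's English description precedes it below -/
import Mathlib

section
/- Let A be an n×n nonnegative real matrix, L[A] its Laplacian, Γ = diag(γ₁,…,γₙ) with γᵢ ≥ 0, and suppose every agent is P-dependent. Then the matrix M = (L[A]+Γ)⁻¹Γ is stochastic: all its entries are nonnegative and each of its rows sums to 1. -/
open Matrix

/-- The Laplacian of a nonnegative matrix `A`. -/
def Lap {n : ℕ} (A : Matrix (Fin n) (Fin n) ℝ) : Matrix (Fin n) (Fin n) ℝ :=
  Matrix.of fun i j => if i = j then ∑ k ∈ Finset.univ.erase i, A i k else -A i j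

/-- Agent `i` is P-dependent. -/
def PDep {n : ℕ} (A : Matrix (Fin n) (Fin n) ℝ) (γ : Fin n → ℝ) (i : Fin n) : Prop :=
  ∃ j, Relation.ReflTransGen (fun p q => 0 < A p q) i j ∧ 0 < γ j

theorem Lap_mulVec_apply {n : ℕ} (A : Matrix (Fin n) (Fin n) ℝ) (x : Fin n → ℝ) (i : Fin n) :
    (Lap A *ᵥ x) i = ∑ k, A i k * (x i - x k) := by
  have h : (Lap A *ᵥ x) i = ∑ k, Lap A i k * x k := rfl
  rw [h, ← Finset.add_sum_erase _ _ (Finset.mem_univ i),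
    ← Finset.add_sum_erase Finset.univ (fun k => A i k * (x i - x k)) (Finset.mem_univ i)]
  have hoff : ∑ k ∈ Finset.univ.erase i, Lap A i k * x k
      = ∑ k ∈ Finset.univ.erase i, -(A i k * x k) := by
    refine Finset.sum_congr rfl fun k hk => ?_
    simp [Lap, (Finset.ne_of_mem_erase hk).symm]
  rw [hoff]
  simp only [Lap, Matrix.of_apply, if_true, sub_self, mul_zero, zero_add, Finset.sum_mul,
    ← Finset.sum_add_distrib]
  exact Finset.sum_congr rfl fun k _ => by ring

theorem Lap_add_diagonal_mulVec_apply {n : ℕ} (A : Matrix (Fin n) (Fin n) ℝ) (γ x : Fin n → ℝ)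
    (i : Fin n) :
    ((Lap A + diagonal γ) *ᵥ x) i = ∑ k, A i k * (x i - x k) + γ i * x i := by
  rw [add_mulVec, Pi.add_apply, Lap_mulVec_apply, mulVec_diagonal]

/-- Minimum principle for the grounded Laplacian. -/
theorem nonneg_of_Lap_add_diagonal_mulVec_nonneg {n : ℕ} {A : Matrix (Fin n) (Fin n) ℝ}
    (hA : ∀ i j, 0 ≤ A i j) {γ : Fin n → ℝ} (hγ : ∀ i, 0 ≤ γ i) (hP : ∀ i, PDep A γ i)
    {x : Fin n → ℝ} (hx : ∀ i, 0 ≤ ((Lap A + diagonal γ) *ᵥ x) i) (i : Fin n) : 0 ≤ x i := by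
  have : Nonempty (Fin n) := ⟨i⟩
  obtain ⟨m, hm⟩ := Finite.exists_min x
  by_contra! hi
  have hneg : x m < 0 := (hm i).trans_lt hi
  have hterm : ∀ p, x p = x m → ∀ k, A p k * (x p - x k) ≤ 0 := fun p hp k =>
    mul_nonpos_of_nonneg_of_nonpos (hA p k) (by linarith [hm k])
  have hrow : ∀ p, 0 ≤ ∑ k, A p k * (x p - x k) + γ p * x p := fun p => by
    rw [← Lap_add_diagonal_mulVec_apply]
    exact hx p
  obtain ⟨j, hmj, hj⟩ := hP m
  have hxj : x j = x m := by
    clear hj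
    induction hmj with
    | refl => rfl
    | @tail p q _ hpq hp =>
      have hsum := hrow p
      have hγp : γ p * x p ≤ 0 := mul_nonpos_of_nonneg_of_nonpos (hγ p) (by linarith)
      have hle : ∑ k, A p k * (x p - x k) ≤ A p q * (x p - x q) := by
        rw [← Finset.add_sum_erase _ _ (Finset.mem_univ q)]
        linarith [Finset.sum_nonpos fun k (_ : k ∈ Finset.univ.erase q) => hterm p hp k]
      have hnonneg : 0 ≤ x p - x q := nonneg_of_mul_nonneg_right (by linarith) hpq
      linarith [hm q]
  have hsum : ∑ k, A j k * (x j - x k) ≤ 0 := Finset.sum_nonpos fun k _ => hterm j hxj k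
  have := hrow j
  rw [hxj] at this hsum
  linarith [mul_neg_of_pos_of_neg hj hneg]

theorem isUnit_Lap_add_diagonal {n : ℕ} {A : Matrix (Fin n) (Fin n) ℝ}
    (hA : ∀ i j, 0 ≤ A i j) {γ : Fin n → ℝ} (hγ : ∀ i, 0 ≤ γ i) (hP : ∀ i, PDep A γ i) :
    IsUnit (Lap A + diagonal γ) := by
  refine mulVec_injective_iff_isUnit.1 fun x y hxy => ?_
  have hle : ∀ u v : Fin n → ℝ, (Lap A + diagonal γ) *ᵥ u = (Lap A + diagonal γ) *ᵥ v →
      ∀ i, 0 ≤ (u - v) i := fun u v huv =>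
    nonneg_of_Lap_add_diagonal_mulVec_nonneg hA hγ hP fun i => by
      rw [mulVec_sub, huv, sub_self, Pi.zero_apply]
  funext i
  have h₁ := hle x y hxy i
  have h₂ := hle y x hxy.symm i
  simp only [Pi.sub_apply] at h₁ h₂
  linarith

theorem Lap_add_diagonal_inv_nonneg {n : ℕ} {A : Matrix (Fin n) (Fin n) ℝ}
    (hA : ∀ i j, 0 ≤ A i j) {γ : Fin n → ℝ} (hγ : ∀ i, 0 ≤ γ i) (hP : ∀ i, PDep A γ i)
    (i j : Fin n) : 0 ≤ (Lap A + diagonal γ)⁻¹ i j := by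
  have hdet := (isUnit_iff_isUnit_det _).1 (isUnit_Lap_add_diagonal hA hγ hP)
  refine nonneg_of_Lap_add_diagonal_mulVec_nonneg hA hγ hP
    (x := fun k => (Lap A + diagonal γ)⁻¹ k j) (fun k => ?_) i
  have h : ((Lap A + diagonal γ) *ᵥ fun k => (Lap A + diagonal γ)⁻¹ k j) k
      = ((Lap A + diagonal γ) * (Lap A + diagonal γ)⁻¹) k j := rfl
  rw [h, mul_nonsing_inv _ hdet, one_apply]
  split_ifs <;> norm_num

theorem Lap_add_diagonal_inv_mulVec {n : ℕ} {A : Matrix (Fin n) (Fin n) ℝ}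
    (hA : ∀ i j, 0 ≤ A i j) {γ : Fin n → ℝ} (hγ : ∀ i, 0 ≤ γ i) (hP : ∀ i, PDep A γ i) :
    (Lap A + diagonal γ)⁻¹ *ᵥ γ = fun _ => 1 := by
  have hdet := (isUnit_iff_isUnit_det _).1 (isUnit_Lap_add_diagonal hA hγ hP)
  have h : (Lap A + diagonal γ) *ᵥ (fun _ => 1) = γ := by
    funext i
    simp [Lap_add_diagonal_mulVec_apply]
  calc (Lap A + diagonal γ)⁻¹ *ᵥ γ
      = (Lap A + diagonal γ)⁻¹ *ᵥ ((Lap A + diagonal γ) *ᵥ fun _ => 1) := by rw [h]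
    _ = fun _ => 1 := by rw [mulVec_mulVec, nonsing_inv_mul _ hdet, one_mulVec]

theorem stmt2 {n : ℕ} (A : Matrix (Fin n) (Fin n) ℝ) (hA : ∀ i j, 0 ≤ A i j)
    (γ : Fin n → ℝ) (hγ : ∀ i, 0 ≤ γ i) (hP : ∀ i, PDep A γ i) :
    (∀ i j, 0 ≤ ((Lap A + Matrix.diagonal γ)⁻¹ * Matrix.diagonal γ) i j) ∧
    (∀ i, ∑ j, ((Lap A + Matrix.diagonal γ)⁻¹ * Matrix.diagonal γ) i j = 1) := by
  simp only [mul_diagonal]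
  exact ⟨fun i j => mul_nonneg (Lap_add_diagonal_inv_nonneg hA hγ hP i j) (hγ j),
    fun i => congrFun (Lap_add_diagonal_inv_mulVec hA hγ hP) i⟩
end

section
/- Let W be an n×n fully regular stochastic matrix, i.e., lim_{k→∞} W^k = 𝟙ₙ p_∞ᵀ for some probability vector p_∞ ∈ ℝⁿ (where 𝟙ₙ is the all-ones vector). For α ∈ (0,1) define V_α = (1−α)(I − αW)⁻¹ and the influence centrality vector c_α = n⁻¹ V_αᵀ 𝟙ₙ. Then V_α → 𝟙ₙ p_∞ᵀ and c_α → p_∞ as α → 1−. -/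
open Matrix Filter Topology

section PowerLimit

variable {ι : Type*} [Fintype ι] [DecidableEq ι] {W P : Matrix ι ι ℝ}

theorem mul_eq_of_tendsto_pow (h : Tendsto (fun k => W ^ k) atTop (𝓝 P)) : W * P = P := by
  have h1 : Tendsto (fun k => W * W ^ k) atTop (𝓝 (W * P)) := h.const_mul W
  simp only [← pow_succ'] at h1
  exact tendsto_nhds_unique h1 ((tendsto_add_atTop_iff_nat 1).2 h)

theorem eq_mul_of_tendsto_pow (h : Tendsto (fun k => W ^ k) atTop (𝓝 P)) : P * W = P := by
  have h1 : Tendsto (fun k => W ^ k * W) atTop (𝓝 (P * W)) := h.mul_const W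
  simp only [← pow_succ] at h1
  exact tendsto_nhds_unique h1 ((tendsto_add_atTop_iff_nat 1).2 h)

theorem pow_mul_eq_of_mul_eq (hWP : W * P = P) (k : ℕ) : W ^ k * P = P := by
  induction k with
  | zero => simp
  | succ k ih => rw [pow_succ, mul_assoc, hWP, ih]

theorem mul_self_of_tendsto_pow (h : Tendsto (fun k => W ^ k) atTop (𝓝 P)) : P * P = P := by
  have h1 : Tendsto (fun k => W ^ k * P) atTop (𝓝 (P * P)) := h.mul_const P
  simp only [pow_mul_eq_of_mul_eq (mul_eq_of_tendsto_pow h)] at h1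
  exact tendsto_nhds_unique h1 tendsto_const_nhds

theorem sub_pow_succ_of_tendsto_pow (h : Tendsto (fun k => W ^ k) atTop (𝓝 P)) (k : ℕ) :
    (W - P) ^ (k + 1) = W ^ (k + 1) - P := by
  induction k with
  | zero => simp
  | succ k ih =>
    rw [pow_succ, ih, sub_mul, mul_sub, mul_sub, ← pow_succ,
      pow_mul_eq_of_mul_eq (mul_eq_of_tendsto_pow h), eq_mul_of_tendsto_pow h,
      mul_self_of_tendsto_pow h, sub_self, sub_zero]

theorem det_one_sub_ne_zero_of_tendsto_pow_zero {N : Matrix ι ι ℝ}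
    (h : Tendsto (fun k => N ^ k) atTop (𝓝 0)) : (1 - N).det ≠ 0 := by
  have hdet : Tendsto (fun k => (1 - N ^ k).det) atTop (𝓝 1) := by
    have hc : Continuous fun M : Matrix ι ι ℝ => (1 - M).det :=
      (continuous_const.sub continuous_id).matrix_det
    simpa [Function.comp_def] using (hc.tendsto 0).comp h
  obtain ⟨k, hk⟩ := (hdet.eventually_ne one_ne_zero).exists
  rw [← mul_neg_geom_sum, det_mul] at hk
  exact left_ne_zero_of_mul hk

/-- The resolvent of `W` splits along the limit projection `P` of its powers. -/
theorem smul_inv_one_sub_smul_eq (hWP : W * P = P) (hPW : P * W = P) (hPP : P * P = P) {α : ℝ}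
    (hα : 1 - α ≠ 0) (hdet : (1 - α • (W - P)).det ≠ 0) :
    (1 - α) • (1 - α • W)⁻¹ = P + (1 - α) • ((1 - α • (W - P))⁻¹ * (1 - P)) := by
  set R := (1 - α • (W - P))⁻¹ with hR
  have hu : IsUnit (1 - α • (W - P)).det := hdet.isUnit
  have hNR : (1 - α • (W - P)) * R = 1 := mul_nonsing_inv _ hu
  have hPN : P * (1 - α • (W - P)) = P := by
    rw [mul_sub, mul_smul_comm, mul_sub, hPW, hPP, sub_self, smul_zero, sub_zero, mul_one]
  have hPR : P * R = P := by
    conv_lhs => rw [← hPN, mul_assoc, hNR, mul_one]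
  have hWR : (1 - α • W) * R = 1 - α • P := by
    have hsplit : 1 - α • W = (1 - α • (W - P)) - α • P := by
      rw [smul_sub]; abel
    rw [hsplit, sub_mul, hNR, smul_mul_assoc, hPR]
  have hinv : (1 - α • W) * ((1 - α)⁻¹ • P + R * (1 - P)) = 1 := by
    rw [mul_add, ← mul_assoc, hWR, mul_smul_comm, sub_mul, one_mul, smul_mul_assoc, hWP,
      sub_mul, one_mul, smul_mul_assoc, mul_sub, mul_one, hPP, sub_self, smul_zero, sub_zero]
    have hP : P - α • P = (1 - α) • P := by rw [sub_smul, one_smul]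
    rw [hP, smul_smul, inv_mul_cancel₀ hα, one_smul, add_sub_cancel]
  rw [inv_eq_right_inv hinv, smul_add, smul_smul, mul_inv_cancel₀ hα, one_smul]

/-- If the powers of `W` converge, then its Abel means have the same limit. -/
theorem tendsto_smul_inv_one_sub_smul (h : Tendsto (fun k => W ^ k) atTop (𝓝 P)) :
    Tendsto (fun α : ℝ => (1 - α) • (1 - α • W)⁻¹) (𝓝[≠] 1) (𝓝 P) := by
  have hpow : Tendsto (fun k => (W - P) ^ k) atTop (𝓝 0) := by
    rw [← tendsto_add_atTop_iff_nat 1]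
    simp only [sub_pow_succ_of_tendsto_pow h]
    simpa using ((tendsto_add_atTop_iff_nat 1).2 h).sub_const P
  have hdet := det_one_sub_ne_zero_of_tendsto_pow_zero hpow
  have hc : Continuous fun α : ℝ => 1 - α • (W - P) := by fun_prop
  have hcdet : Tendsto (fun α : ℝ => (1 - α • (W - P)).det) (𝓝 1) (𝓝 (1 - (W - P)).det) := by
    simpa using hc.matrix_det.tendsto 1
  have hR : Tendsto (fun α : ℝ => (1 - α • (W - P))⁻¹) (𝓝 1) (𝓝 (1 - (W - P))⁻¹) := by
    simp only [inv_def, Ring.inverse_eq_inv']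
    refine (hcdet.inv₀ hdet).smul ?_
    simpa using hc.matrix_adjugate.tendsto 1
  have hα : Tendsto (fun α : ℝ => 1 - α) (𝓝 1) (𝓝 0) := by
    have hcont : Continuous fun α : ℝ => 1 - α := by fun_prop
    simpa using hcont.tendsto 1
  have hlim : Tendsto (fun α : ℝ => P + (1 - α) • ((1 - α • (W - P))⁻¹ * (1 - P)))
      (𝓝 1) (𝓝 P) := by
    simpa using (hα.smul (hR.mul_const (1 - P))).const_add P
  refine (hlim.mono_left nhdsWithin_le_nhds).congr' ?_
  filter_upwards [self_mem_nhdsWithin,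
    nhdsWithin_le_nhds (hcdet.eventually_ne hdet)] with α hα1 hαdet
  exact (smul_inv_one_sub_smul_eq (mul_eq_of_tendsto_pow h) (eq_mul_of_tendsto_pow h)
    (mul_self_of_tendsto_pow h) (sub_ne_zero.2 (Ne.symm hα1)) hαdet).symm

end PowerLimit

theorem stmt15 {n : ℕ} (hn : 0 < n) (W : Matrix (Fin n) (Fin n) ℝ)
    (hW0 : ∀ i j, 0 ≤ W i j) (hW1 : ∀ i, ∑ j, W i j = 1)
    (pinf : Fin n → ℝ) (hp0 : ∀ i, 0 ≤ pinf i) (hp1 : ∑ i, pinf i = 1)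
    (hreg : Tendsto (fun k => W ^ k) atTop
      (𝓝 (Matrix.of fun _ j => pinf j))) :
    Tendsto (fun α : ℝ => (1 - α) • (1 - α • W)⁻¹) (𝓝[<] 1)
      (𝓝 (Matrix.of fun _ j => pinf j)) ∧
    Tendsto (fun α : ℝ => fun i => (n : ℝ)⁻¹ * ∑ j, ((1 - α) • (1 - α • W)⁻¹) j i)
      (𝓝[<] 1) (𝓝 pinf) := by
  have hV : Tendsto (fun α : ℝ => (1 - α) • (1 - α • W)⁻¹) (𝓝[<] 1)
      (𝓝 (Matrix.of fun _ j => pinf j)) :=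
    (tendsto_smul_inv_one_sub_smul hreg).mono_left
      (nhdsWithin_mono 1 fun _ hx => ne_of_lt hx)
  refine ⟨hV, ?_⟩
  have hc : Continuous fun (M : Matrix (Fin n) (Fin n) ℝ) (i : Fin n) =>
      (n : ℝ)⁻¹ * ∑ j, M j i := by fun_prop
  have hn0 : (n : ℝ) ≠ 0 := Nat.cast_ne_zero.2 hn.ne'
  have hval : (fun i : Fin n => (n : ℝ)⁻¹ *
      ∑ j : Fin n, (Matrix.of fun (_ : Fin n) j => pinf j) j i) = pinf := by
    funext i
    simp [hn0]
  have hlim := (hc.tendsto (Matrix.of fun _ j => pinf j)).comp hV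
  rwa [hval] at hlim
end
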